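/- arXiv:2004.11812 — 5 statements merged into one kernel-verified Lean document; each statement's English description precedes it below -/
import Mathlib

section
/- Let C be a finite nonempty type, let p̃ and μ be probability vectors on C, let L : C → ℝ satisfy L c > 0 for all c, and let α ≥ 0. Define M := ∑_c L c * p̃ c, the posterior b c := (L c * p̃ c) / M, the normalizer Z := ∑_c (b c)^(1/(1+α)) * (μ c)^(α/(1+α)), and the tempered posterior g c := (b c)^(1/(1+α)) * (μ c)^(α/(1+α)) / Z. Then for every probability vector p on C: (1+α) * KL(p‖g) = −(∑_c p c * log (L c)) + KL(p‖p̃) + α * KL(p‖μ) + (1+α) * log Z + log M. -/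
/-- Finite-context form of the KL decomposition behind Theorem 1: for the tempered
posterior `g` built from the posterior `b` and target `mu`,
`(1+α) KL(p‖g) = −E_p[log L] + KL(p‖pt) + α KL(p‖mu) + (1+α) log Z + log M`. -/
theorem tempered_posterior_kl_decomposition {C : Type*} [Fintype C] [Nonempty C]
    (pt mu : C → ℝ)
    (hpt : ∀ c, 0 < pt c) (hpt1 : ∑ c, pt c = 1)
    (hmu : ∀ c, 0 < mu c) (hmu1 : ∑ c, mu c = 1)
    (L : C → ℝ) (hL : ∀ c, 0 < L c)
    (α : ℝ) (hα : 0 ≤ α)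
    (M : ℝ) (hM : M = ∑ c, L c * pt c)
    (b : C → ℝ) (hb : ∀ c, b c = (L c * pt c) / M)
    (Z : ℝ) (hZ : Z = ∑ c, (b c) ^ (1 / (1 + α)) * (mu c) ^ (α / (1 + α)))
    (g : C → ℝ) (hg : ∀ c, g c = (b c) ^ (1 / (1 + α)) * (mu c) ^ (α / (1 + α)) / Z)
    (p : C → ℝ) (hp : ∀ c, 0 < p c) (hp1 : ∑ c, p c = 1) :
    (1 + α) * (∑ c, p c * Real.log (p c / g c))
      = -(∑ c, p c * Real.log (L c))
        + (∑ c, p c * Real.log (p c / pt c))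
        + α * (∑ c, p c * Real.log (p c / mu c))
        + (1 + α) * Real.log Z + Real.log M := by
  have hMpos : 0 < M :=
    hM ▸ Finset.sum_pos (fun c _ => mul_pos (hL c) (hpt c)) Finset.univ_nonempty
  have hbpos : ∀ c, 0 < b c := fun c => hb c ▸ div_pos (mul_pos (hL c) (hpt c)) hMpos
  have hwpos : ∀ c, 0 < b c ^ (1 / (1 + α)) * mu c ^ (α / (1 + α)) := fun c =>
    mul_pos (Real.rpow_pos_of_pos (hbpos c) _) (Real.rpow_pos_of_pos (hmu c) _)
  have hZpos : 0 < Z := hZ ▸ Finset.sum_pos (fun c _ => hwpos c) Finset.univ_nonempty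
  have hα' : 1 + α ≠ 0 := by positivity
  have hgpos : ∀ c, 0 < g c := fun c => hg c ▸ div_pos (hwpos c) hZpos
  have hlog : ∀ c, (1 + α) * Real.log (g c)
      = Real.log (L c) + Real.log (pt c) - Real.log M + α * Real.log (mu c)
        - (1 + α) * Real.log Z := by
    intro c
    rw [hg c, Real.log_div (hwpos c).ne' hZpos.ne',
      Real.log_mul (Real.rpow_pos_of_pos (hbpos c) _).ne' (Real.rpow_pos_of_pos (hmu c) _).ne',
      Real.log_rpow (hbpos c), Real.log_rpow (hmu c), hb c,
      Real.log_div (mul_pos (hL c) (hpt c)).ne' hMpos.ne', Real.log_mul (hL c).ne' (hpt c).ne']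
    field_simp
  have hconst : (1 + α) * Real.log Z + Real.log M
      = ∑ c, p c * ((1 + α) * Real.log Z + Real.log M) := by
    rw [← Finset.sum_mul, hp1, one_mul]
  rw [add_assoc _ ((1 + α) * Real.log Z), hconst, Finset.mul_sum, Finset.mul_sum,
    ← Finset.sum_neg_distrib, ← Finset.sum_add_distrib, ← Finset.sum_add_distrib,
    ← Finset.sum_add_distrib]
  refine Finset.sum_congr rfl fun c _ => ?_
  rw [Real.log_div (hp c).ne' (hgpos c).ne', Real.log_div (hp c).ne' (hpt c).ne',
    Real.log_div (hp c).ne' (hmu c).ne']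
  linear_combination -p c * hlog c
end

section
/- Let C be a finite nonempty type, let p̃ and μ be probability vectors on C, let L : C → ℝ satisfy L c > 0 for all c, and let α ≥ 0. Define M := ∑_c L c * p̃ c, b c := (L c * p̃ c) / M, Z := ∑_c (b c)^(1/(1+α)) * (μ c)^(α/(1+α)), and g c := (b c)^(1/(1+α)) * (μ c)^(α/(1+α)) / Z. For a probability vector p, set F(p) := (∑_c p c * log (L c)) − KL(p‖p̃) − α * KL(p‖μ). Then for every set 𝒫 of probability vectors on C and every p* ∈ 𝒫: p* minimizes p ↦ KL(p‖g) over 𝒫 if and only if p* maximizes F over 𝒫. -/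
/-- The integrand of the self-paced objective equals, up to an additive constant, `-(1 + α)` times
the log-ratio to the tempered posterior. -/
theorem log_sub_log_div_sub_mul_log_div {l q m x M Z α : ℝ} (hl : 0 < l) (hq : 0 < q) (hm : 0 < m)
    (hx : 0 < x) (hM : 0 < M) (hZ : 0 < Z) (hα : 1 + α ≠ 0) :
    Real.log l - Real.log (x / q) - α * Real.log (x / m) =
      (Real.log M + (1 + α) * Real.log Z) - (1 + α) *
        Real.log (x / ((l * q / M) ^ (1 / (1 + α)) * m ^ (α / (1 + α)) / Z)) := by
  have hb : 0 < l * q / M := by positivity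
  have hb' := Real.rpow_pos_of_pos hb (1 / (1 + α))
  have hm' := Real.rpow_pos_of_pos hm (α / (1 + α))
  rw [Real.log_div hx.ne' hq.ne', Real.log_div hx.ne' hm.ne',
    Real.log_div hx.ne' (by positivity), Real.log_div (by positivity) hZ.ne',
    Real.log_mul hb'.ne' hm'.ne', Real.log_rpow hb, Real.log_rpow hm,
    Real.log_div (by positivity) hM.ne', Real.log_mul hl.ne' hq.ne']
  field_simp
  ring


/-- Finite-context form of Theorem 1: over any set `Pfam` of probability vectors,
`p*` minimizes the KL divergence to the tempered posterior `g` iff `p*` maximizes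
the self-paced objective `F p = E_p[log L] − KL(p‖pt) − α KL(p‖mu)`. -/
theorem self_paced_objective_iff_regularized_e_step {C : Type*} [Fintype C] [Nonempty C]
    (pt mu : C → ℝ)
    (hpt : ∀ c, 0 < pt c) (hpt1 : ∑ c, pt c = 1)
    (hmu : ∀ c, 0 < mu c) (hmu1 : ∑ c, mu c = 1)
    (L : C → ℝ) (hL : ∀ c, 0 < L c)
    (α : ℝ) (hα : 0 ≤ α)
    (M : ℝ) (hM : M = ∑ c, L c * pt c)
    (b : C → ℝ) (hb : ∀ c, b c = (L c * pt c) / M)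
    (Z : ℝ) (hZ : Z = ∑ c, (b c) ^ (1 / (1 + α)) * (mu c) ^ (α / (1 + α)))
    (g : C → ℝ) (hg : ∀ c, g c = (b c) ^ (1 / (1 + α)) * (mu c) ^ (α / (1 + α)) / Z)
    (F : (C → ℝ) → ℝ)
    (hF : ∀ p, F p = (∑ c, p c * Real.log (L c))
        - (∑ c, p c * Real.log (p c / pt c))
        - α * (∑ c, p c * Real.log (p c / mu c)))
    (Pfam : Set (C → ℝ)) (hPfam : ∀ p ∈ Pfam, (∀ c, 0 < p c) ∧ ∑ c, p c = 1)
    (pstar : C → ℝ) (hpstar : pstar ∈ Pfam) :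
    (∀ p ∈ Pfam, (∑ c, pstar c * Real.log (pstar c / g c)) ≤ ∑ c, p c * Real.log (p c / g c))
      ↔ (∀ p ∈ Pfam, F p ≤ F pstar) := by
  have hα1 : 0 < 1 + α := by linarith
  have hMpos : 0 < M := by
    rw [hM]
    exact Finset.sum_pos (fun c _ => mul_pos (hL c) (hpt c)) Finset.univ_nonempty
  have hbpos : ∀ c, 0 < b c := fun c => by
    rw [hb]
    exact div_pos (mul_pos (hL c) (hpt c)) hMpos
  have hZpos : 0 < Z := by
    rw [hZ]
    exact Finset.sum_pos (fun c _ => mul_pos (Real.rpow_pos_of_pos (hbpos c) _)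
      (Real.rpow_pos_of_pos (hmu c) _)) Finset.univ_nonempty
  have key : ∀ p ∈ Pfam, F p = (Real.log M + (1 + α) * Real.log Z) -
      (1 + α) * ∑ c, p c * Real.log (p c / g c) := by
    intro p hp
    obtain ⟨hp0, hp1⟩ := hPfam p hp
    have hconst : Real.log M + (1 + α) * Real.log Z =
        ∑ c, p c * (Real.log M + (1 + α) * Real.log Z) := by
      rw [← Finset.sum_mul, hp1, one_mul]
    rw [hF, hconst, Finset.mul_sum, Finset.mul_sum, ← Finset.sum_sub_distrib, ← Finset.sum_sub_distrib,
      ← Finset.sum_sub_distrib]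
    refine Finset.sum_congr rfl fun c _ => ?_
    have h := log_sub_log_div_sub_mul_log_div (hL c) (hpt c) (hmu c) (hp0 c) hMpos hZpos hα1.ne'
    rw [← hb, ← hg] at h
    linear_combination p c * h
  refine forall₂_congr fun p hp => ?_
  rw [key p hp, key pstar hpstar, sub_le_sub_iff_left, mul_le_mul_iff_right₀ hα1]
end

section
/- Let C be a finite nonempty type, let a and b be probability vectors on C, and let α ≥ 0. Define Z := ∑_c (a c)^(1/(1+α)) * (b c)^(α/(1+α)) and g c := (a c)^(1/(1+α)) * (b c)^(α/(1+α)) / Z. Then for every probability vector q on C: KL(q‖a) + α * KL(q‖b) ≥ KL(g‖a) + α * KL(g‖b), with equality if and only if q = g. In other words, the geometric mixture g is the unique minimizer of q ↦ KL(q‖a) + α * KL(q‖b) over probability vectors on C. -/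
open InformationTheory in
/-- If `p` and `g` have the same total mass, then `KL(p‖g)` is a `g`-weighted sum of `klFun`. -/
theorem sum_mul_log_div_eq_sum_klFun {C : Type*} [Fintype C] {p g : C → ℝ}
    (hg : ∀ c, 0 < g c) (h : ∑ c, p c = ∑ c, g c) :
    ∑ c, p c * Real.log (p c / g c) = ∑ c, g c * klFun (p c / g c) := by
  have key : ∀ c, g c * klFun (p c / g c) = p c * Real.log (p c / g c) + (g c - p c) := by
    intro c
    have := (hg c).ne'
    rw [klFun_apply]
    field_simp
    ring
  simp only [key, Finset.sum_add_distrib, Finset.sum_sub_distrib, h, sub_self, add_zero]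

open InformationTheory in
/-- Gibbs' inequality. -/
theorem sum_mul_log_div_nonneg {C : Type*} [Fintype C] {p g : C → ℝ}
    (hp : ∀ c, 0 < p c) (hg : ∀ c, 0 < g c) (h : ∑ c, p c = ∑ c, g c) :
    0 ≤ ∑ c, p c * Real.log (p c / g c) := by
  rw [sum_mul_log_div_eq_sum_klFun hg h]
  exact Finset.sum_nonneg fun c _ =>
    mul_nonneg (hg c).le (klFun_nonneg (div_pos (hp c) (hg c)).le)

open InformationTheory in
/-- The equality case of Gibbs' inequality. -/
theorem sum_mul_log_div_eq_zero_iff {C : Type*} [Fintype C] {p g : C → ℝ}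
    (hp : ∀ c, 0 < p c) (hg : ∀ c, 0 < g c) (h : ∑ c, p c = ∑ c, g c) :
    ∑ c, p c * Real.log (p c / g c) = 0 ↔ p = g := by
  have hpg : ∀ c, 0 ≤ p c / g c := fun c => (div_pos (hp c) (hg c)).le
  rw [sum_mul_log_div_eq_sum_klFun hg h, Finset.sum_eq_zero_iff_of_nonneg fun c _ =>
    mul_nonneg (hg c).le (klFun_nonneg (hpg c)), funext_iff]
  simp only [Finset.mem_univ, true_implies, mul_eq_zero, (hg _).ne', false_or,
    klFun_eq_zero_iff (hpg _), div_eq_one_iff_eq (hg _).ne']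

/-- The regularized objective is, up to scaling and an additive constant, the divergence to the
normalized geometric mixture. -/
theorem klDiv_add_mul_klDiv_eq_geometric_mixture {C : Type*} [Fintype C] {a b p : C → ℝ}
    {α Z : ℝ} (ha : ∀ c, 0 < a c) (hb : ∀ c, 0 < b c) (hα : 0 ≤ α) (hZ : 0 < Z)
    (hp : ∀ c, 0 < p c) (hp1 : ∑ c, p c = 1) :
    (∑ c, p c * Real.log (p c / a c)) + α * (∑ c, p c * Real.log (p c / b c))
      = (1 + α) * (∑ c, p c * Real.log
          (p c / ((a c) ^ (1 / (1 + α)) * (b c) ^ (α / (1 + α)) / Z)))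
        - (1 + α) * Real.log Z := by
  have key : ∀ c, p c * Real.log (p c / a c) + α * (p c * Real.log (p c / b c))
      = (1 + α) * (p c * Real.log
          (p c / ((a c) ^ (1 / (1 + α)) * (b c) ^ (α / (1 + α)) / Z)))
        - p c * ((1 + α) * Real.log Z) := by
    intro c
    have hA := Real.rpow_pos_of_pos (ha c) (1 / (1 + α))
    have hB := Real.rpow_pos_of_pos (hb c) (α / (1 + α))
    have h1 : 1 + α ≠ 0 := by positivity
    rw [Real.log_div (hp c).ne' (ha c).ne', Real.log_div (hp c).ne' (hb c).ne',
      Real.log_div (hp c).ne' (by positivity), Real.log_div (by positivity) hZ.ne',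
      Real.log_mul hA.ne' hB.ne', Real.log_rpow (ha c), Real.log_rpow (hb c)]
    field_simp
    ring
  rw [Finset.mul_sum, Finset.mul_sum, ← Finset.sum_add_distrib, Finset.sum_congr rfl fun c _ => key c,
    Finset.sum_sub_distrib, ← Finset.sum_mul, hp1, one_mul]

/-- The geometric mixture `g` is the unique minimizer of
`q ↦ KL(q‖a) + α KL(q‖b)` over probability vectors. -/
theorem geometric_mixture_unique_minimizer {C : Type*} [Fintype C] [Nonempty C]
    (a b : C → ℝ)
    (ha : ∀ c, 0 < a c) (ha1 : ∑ c, a c = 1)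
    (hb : ∀ c, 0 < b c) (hb1 : ∑ c, b c = 1)
    (α : ℝ) (hα : 0 ≤ α)
    (Z : ℝ) (hZ : Z = ∑ c, (a c) ^ (1 / (1 + α)) * (b c) ^ (α / (1 + α)))
    (g : C → ℝ) (hg : ∀ c, g c = (a c) ^ (1 / (1 + α)) * (b c) ^ (α / (1 + α)) / Z)
    (q : C → ℝ) (hq : ∀ c, 0 < q c) (hq1 : ∑ c, q c = 1) :
    ((∑ c, g c * Real.log (g c / a c)) + α * (∑ c, g c * Real.log (g c / b c))
        ≤ (∑ c, q c * Real.log (q c / a c)) + α * (∑ c, q c * Real.log (q c / b c)))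
    ∧ ((∑ c, q c * Real.log (q c / a c)) + α * (∑ c, q c * Real.log (q c / b c))
        = (∑ c, g c * Real.log (g c / a c)) + α * (∑ c, g c * Real.log (g c / b c))
        ↔ q = g) := by
  have hw : ∀ c, 0 < (a c) ^ (1 / (1 + α)) * (b c) ^ (α / (1 + α)) := fun c =>
    mul_pos (Real.rpow_pos_of_pos (ha c) _) (Real.rpow_pos_of_pos (hb c) _)
  have hZ0 : 0 < Z := hZ ▸ Finset.sum_pos (fun c _ => hw c) Finset.univ_nonempty
  have hg0 : ∀ c, 0 < g c := fun c => hg c ▸ div_pos (hw c) hZ0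
  have hg1 : ∑ c, g c = 1 := by
    simp only [hg]
    rw [← Finset.sum_div, ← hZ, div_self hZ0.ne']
  have hsum : ∑ c, q c = ∑ c, g c := hq1.trans hg1.symm
  have hα1 : 0 < 1 + α := by positivity
  have eq_q := klDiv_add_mul_klDiv_eq_geometric_mixture ha hb hα hZ0 hq hq1
  have eq_g := klDiv_add_mul_klDiv_eq_geometric_mixture ha hb hα hZ0 hg0 hg1
  simp only [← hg] at eq_q eq_g
  rw [(sum_mul_log_div_eq_zero_iff hg0 hg0 rfl).2 rfl, mul_zero] at eq_g
  rw [eq_q, eq_g]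
  refine ⟨sub_le_sub_right (mul_nonneg hα1.le (sum_mul_log_div_nonneg hq hg0 hsum)) _, ?_⟩
  rw [sub_left_inj, mul_eq_zero, or_iff_right hα1.ne', sum_mul_log_div_eq_zero_iff hq hg0 hsum]
end

section
/- Let S be a finite nonempty type, γ ∈ [0, 1], and let p : S → S → ℝ be a stochastic kernel, i.e. p s s' ≥ 0 for all s, s' and ∑_{s'} p s s' = 1 for all s. Define the modified kernel p̄ on Option S by p̄ (some s) (some s') := γ * p s s', p̄ (some s) none := 1 − γ, p̄ none none := 1, and p̄ none (some s') := 0. Fix s₀ : S. Define ν : ℕ → Option S → ℝ by ν 0 x := (1 if x = some s₀ else 0) and ν (t+1) x' := ∑_x ν t x * p̄ x x', and define μ : ℕ → S → ℝ by μ 0 s := (1 if s = s₀ else 0) and μ (t+1) s' := ∑_s μ t s * p s s'. Then for every t : ℕ and every s : S, ν t (some s) = γ ^ t * μ t s. -/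
/-- The time-`t` marginal of the modified chain (with absorbing terminal state `none`)
on non-terminal states equals the time-`t` marginal of the original chain discounted
by `γ ^ t`. -/
theorem modified_marginal_eq_discounted_marginal {S : Type*} [Fintype S] [DecidableEq S] [Nonempty S]
    (γ : ℝ) (hγ0 : 0 ≤ γ) (hγ1 : γ ≤ 1)
    (p : S → S → ℝ) (hp0 : ∀ s s', 0 ≤ p s s') (hp1 : ∀ s, ∑ s', p s s' = 1)
    (pbar : Option S → Option S → ℝ)
    (hbar1 : ∀ s s', pbar (some s) (some s') = γ * p s s')
    (hbar2 : ∀ s, pbar (some s) none = 1 - γ)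
    (hbar3 : pbar none none = 1)
    (hbar4 : ∀ s', pbar none (some s') = 0)
    (s₀ : S)
    (ν : ℕ → Option S → ℝ)
    (hν0 : ∀ x, ν 0 x = if x = some s₀ then 1 else 0)
    (hνs : ∀ t x', ν (t + 1) x' = ∑ x, ν t x * pbar x x')
    (μ : ℕ → S → ℝ)
    (hμ0 : ∀ s, μ 0 s = if s = s₀ then 1 else 0)
    (hμs : ∀ t s', μ (t + 1) s' = ∑ s, μ t s * p s s') :
    ∀ (t : ℕ) (s : S), ν t (some s) = γ ^ t * μ t s := by
  intro t
  induction t with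
  | zero => intro s; simp [hν0, hμ0]
  | succ t ih =>
    intro s
    rw [hνs, hμs, Fintype.sum_option, hbar4, mul_zero, zero_add, Finset.mul_sum]
    refine Finset.sum_congr rfl fun x _ => ?_
    rw [ih, hbar1]
    ring
end

section
/- Let S be a finite nonempty type, γ ∈ [0, 1], and let p : S → S → ℝ be a stochastic kernel, i.e. p s s' ≥ 0 for all s, s' and ∑_{s'} p s s' = 1 for all s. Define the modified kernel p̄ on Option S by p̄ (some s) (some s') := γ * p s s', p̄ (some s) none := 1 − γ, p̄ none none := 1, and p̄ none (some s') := 0. Fix s₀ : S, and define ν : ℕ → Option S → ℝ by ν 0 x := (1 if x = some s₀ else 0) and ν (t+1) x' := ∑_x ν t x * p̄ x x', and μ : ℕ → S → ℝ by μ 0 s := (1 if s = s₀ else 0) and μ (t+1) s' := ∑_s μ t s * p s s'. Let r : S → ℝ be a reward function and extend it by r̄ (some s) := r s and r̄ none := 0. Then for every horizon T : ℕ: ∑_{t < T} ∑_{x : Option S} ν t x * r̄ x = ∑_{t < T} γ ^ t * ∑_{s : S} μ t s * r s. -/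
/-- The expected undiscounted cumulative reward under the modified dynamics (with
absorbing, zero-reward terminal state `none`) equals the expected `γ`-discounted
cumulative reward under the original dynamics. -/
theorem modified_dynamics_recover_discounted_reward {S : Type*} [Fintype S] [DecidableEq S] [Nonempty S]
    (γ : ℝ) (hγ0 : 0 ≤ γ) (hγ1 : γ ≤ 1)
    (p : S → S → ℝ) (hp0 : ∀ s s', 0 ≤ p s s') (hp1 : ∀ s, ∑ s', p s s' = 1)
    (pbar : Option S → Option S → ℝ)
    (hbar1 : ∀ s s', pbar (some s) (some s') = γ * p s s')
    (hbar2 : ∀ s, pbar (some s) none = 1 - γ)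
    (hbar3 : pbar none none = 1)
    (hbar4 : ∀ s', pbar none (some s') = 0)
    (s₀ : S)
    (ν : ℕ → Option S → ℝ)
    (hν0 : ∀ x, ν 0 x = if x = some s₀ then 1 else 0)
    (hνs : ∀ t x', ν (t + 1) x' = ∑ x, ν t x * pbar x x')
    (μ : ℕ → S → ℝ)
    (hμ0 : ∀ s, μ 0 s = if s = s₀ then 1 else 0)
    (hμs : ∀ t s', μ (t + 1) s' = ∑ s, μ t s * p s s')
    (r : S → ℝ)
    (rbar : Option S → ℝ)
    (hrbar1 : ∀ s, rbar (some s) = r s)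
    (hrbar2 : rbar none = 0) :
    ∀ T : ℕ,
      ∑ t ∈ Finset.range T, ∑ x : Option S, ν t x * rbar x
        = ∑ t ∈ Finset.range T, γ ^ t * ∑ s : S, μ t s * r s := by
  have key : ∀ t s, ν t (some s) = γ ^ t * μ t s := by
    intro t
    induction t with
    | zero => intro s; simp [hν0, hμ0]
    | succ t ih =>
      intro s
      rw [hνs, hμs, Fintype.sum_option, hbar4, mul_zero, zero_add, Finset.mul_sum]
      refine Finset.sum_congr rfl fun x _ => ?_
      rw [ih, hbar1]
      ring
  intro T
  refine Finset.sum_congr rfl fun t _ => ?_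
  rw [Fintype.sum_option, hrbar2, mul_zero, zero_add, Finset.mul_sum]
  refine Finset.sum_congr rfl fun s _ => ?_
  rw [key, hrbar1, mul_assoc]
end
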